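/- In the chain-plus-loops graph Γ: let r be an integer with 1 ≤ r ≤ g − a − 2 and let D be an effective divisor of degree a + 2r supported on Γ₀. Then rk_Γ(D) ≥ r. -/

import Mathlib

noncomputable section

/-- The star with `n` rays of radius `r` in the complex plane:
`{ z ∈ ℂ : z = t·e^{2πik/n}, t ∈ [0,r], k ∈ ℤ }`. -/
def starSet (n : ℕ) (r : ℝ) : Set ℂ :=
  {z | ∃ t ∈ Set.Icc (0 : ℝ) r, ∃ k : ℤ,
    z = (t : ℂ) * Complex.exp (2 * (Real.pi : ℂ) * Complex.I * (k : ℂ) / (n : ℂ))}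

/-- `P` has a neighbourhood isometric to a star with `n` rays of some radius `r > 0`,
with `P` corresponding to `0`. -/
def HasStarNbhd (Γ : Type*) [MetricSpace Γ] (P : Γ) (n : ℕ) : Prop :=
  ∃ r > (0 : ℝ), ∃ U ∈ nhds P, ∃ φ : Γ → ℂ,
    φ P = 0 ∧ φ '' U = starSet n r ∧
    ∀ x ∈ U, ∀ y ∈ U, dist (φ x) (φ y) = dist x y

/-- A metric graph: a compact connected metric space in which every point has a
neighbourhood isometric to a star with `n ≥ 1` rays. -/
def IsMetricGraph (Γ : Type*) [MetricSpace Γ] : Prop :=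
  CompactSpace Γ ∧ ConnectedSpace Γ ∧ ∀ P : Γ, ∃ n : ℕ, 1 ≤ n ∧ HasStarNbhd Γ P n

/-- The valence of a point: the number of rays of a star neighbourhood. -/
noncomputable def valence (Γ : Type*) [MetricSpace Γ] (P : Γ) : ℕ :=
  sInf {n : ℕ | 1 ≤ n ∧ HasStarNbhd Γ P n}

/-- A vertex is a point of valence different from `2`. -/
def IsVertex (Γ : Type*) [MetricSpace Γ] (P : Γ) : Prop := valence Γ P ≠ 2

/-- The genus of a metric graph: `#edges - #vertices + 1`, the edges being the connected
components of the complement of the vertex set. -/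
noncomputable def graphGenus (Γ : Type*) [MetricSpace Γ] : ℤ :=
  (Nat.card (ConnectedComponents {P : Γ // ¬ IsVertex Γ P}) : ℤ)
    - (Nat.card {P : Γ // IsVertex Γ P} : ℤ) + 1

/-- A divisor on `Γ` : a finitely supported formal `ℤ`-linear combination of points. -/
abbrev Divisor (Γ : Type*) : Type _ := Γ →₀ ℤ

/-- The degree of a divisor. -/
def divDeg {Γ : Type*} (D : Divisor Γ) : ℤ := D.sum fun _ n => n

/-- A divisor is effective if all its coefficients are nonnegative. -/
def Effective {Γ : Type*} (D : Divisor Γ) : Prop := ∀ P : Γ, 0 ≤ D P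

/-- An arc based at `P` : an isometric parametrization of a segment emanating from `P`. -/
def IsArcAt {Γ : Type*} [MetricSpace Γ] (P : Γ) (τ : ℝ → Γ) : Prop :=
  τ 0 = P ∧ ∃ a > (0 : ℝ), ∀ s ∈ Set.Icc (0 : ℝ) a, ∀ t ∈ Set.Icc (0 : ℝ) a,
    dist (τ s) (τ t) = |s - t|

/-- Two arcs are equivalent (define the same tangent direction) when they agree near `0`. -/
def ArcEquiv {Γ : Type*} (τ τ' : ℝ → Γ) : Prop :=
  ∃ ε > (0 : ℝ), ∀ t ∈ Set.Icc (0 : ℝ) ε, τ t = τ' t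

/-- `f` has (one-sided) slope `s` along the arc `τ`. -/
def HasSlopeAlong {Γ : Type*} (f : Γ → ℝ) (τ : ℝ → Γ) (s : ℤ) : Prop :=
  ∃ ε > (0 : ℝ), ∀ t ∈ Set.Icc (0 : ℝ) ε, f (τ t) = f (τ 0) + (s : ℝ) * t

/-- A rational function on a metric graph: continuous and piecewise affine with
integer slopes, i.e. having an integer slope along every arc. -/
def IsRational (Γ : Type*) [MetricSpace Γ] (f : Γ → ℝ) : Prop :=
  Continuous f ∧ ∀ (P : Γ) (τ : ℝ → Γ), IsArcAt P τ → ∃ s : ℤ, HasSlopeAlong f τ s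

/-- `div f` has coefficient `m` at `P`: the sum of the slopes of `f` in all tangent
directions emanating from `P` equals `m`. -/
def HasOrderAt (Γ : Type*) [MetricSpace Γ] (f : Γ → ℝ) (P : Γ) (m : ℤ) : Prop :=
  ∃ (n : ℕ) (τ : Fin n → ℝ → Γ) (s : Fin n → ℤ),
    (∀ i, IsArcAt P (τ i)) ∧
    Pairwise (fun i j => ¬ ArcEquiv (τ i) (τ j)) ∧
    (∀ σ : ℝ → Γ, IsArcAt P σ → ∃ i, ArcEquiv σ (τ i)) ∧
    (∀ i, HasSlopeAlong f (τ i) (s i)) ∧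
    m = ∑ i, s i

/-- Linear equivalence of divisors: `D₂ - D₁ = div f` for some rational function `f`. -/
def LinEquiv (Γ : Type*) [MetricSpace Γ] (D₁ D₂ : Divisor Γ) : Prop :=
  ∃ f : Γ → ℝ, IsRational Γ f ∧ ∀ P : Γ, HasOrderAt Γ f P (D₂ P - D₁ P)

/-- `D` is linearly equivalent to an effective divisor. -/
def EquivEffective (Γ : Type*) [MetricSpace Γ] (D : Divisor Γ) : Prop :=
  ∃ D' : Divisor Γ, Effective D' ∧ LinEquiv Γ D D'

/-- For every effective divisor `E` of degree `r`, `D - E` is linearly equivalent to an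
effective divisor. -/
def RankGE (Γ : Type*) [MetricSpace Γ] (D : Divisor Γ) (r : ℕ) : Prop :=
  ∀ E : Divisor Γ, Effective E → divDeg E = (r : ℤ) → EquivEffective Γ (D - E)

/-- The rank of a divisor: `-1` if `D` is not equivalent to an effective divisor, and
otherwise the largest `r ≥ 0` such that `D - E` is equivalent to an effective divisor
for every effective `E` of degree `r`. -/
noncomputable def divRank (Γ : Type*) [MetricSpace Γ] (D : Divisor Γ) : ℤ :=
  sSup (insert (-1) {n : ℤ | ∃ r : ℕ, n = (r : ℤ) ∧ RankGE Γ D r})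

/-- The arc `τ` immediately leaves the set `X`. -/
def ArcLeaves {Γ : Type*} (X : Set Γ) (τ : ℝ → Γ) : Prop :=
  ∃ ε > (0 : ℝ), ∀ t ∈ Set.Ioc (0 : ℝ) ε, τ t ∉ X

/-- `P` is a non-saturated boundary point of `X` with respect to `D` : the number of
tangent directions at `P` leaving `X` is strictly greater than `D P`. -/
def NonSaturated (Γ : Type*) [MetricSpace Γ] (D : Divisor Γ) (X : Set Γ) (P : Γ) : Prop :=
  P ∈ frontier X ∧ ∃ (n : ℕ) (τ : Fin n → ℝ → Γ),
    (∀ i, IsArcAt P (τ i)) ∧ (∀ i, ArcLeaves X (τ i)) ∧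
    Pairwise (fun i j => ¬ ArcEquiv (τ i) (τ j)) ∧ D P < (n : ℤ)

/-- `D` is `P₀`-reduced. -/
def IsReducedDivisor (Γ : Type*) [MetricSpace Γ] (D : Divisor Γ) (P₀ : Γ) : Prop :=
  (∀ P : Γ, P ≠ P₀ → 0 ≤ D P) ∧
  ∀ X : Set Γ, IsClosed X → X.Nonempty → P₀ ∉ X → ∃ P, NonSaturated Γ D X P

/-- The restriction of a divisor on `Γ` to a divisor on a subset `S` (with the induced
metric); divisors supported on `S` are identified with divisors on `S` this way. -/
noncomputable def DivRestrict {Γ : Type*} (S : Set Γ) (D : Divisor Γ) : Divisor ↥S :=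
  Finsupp.comapDomain Subtype.val D Subtype.coe_injective.injOn

/-- Linear equivalence computed on the subgraph `S` of `Γ`. -/
def LinEquivOn {Γ : Type*} [MetricSpace Γ] (S : Set Γ) (D₁ D₂ : Divisor Γ) : Prop :=
  LinEquiv ↥S (DivRestrict S D₁) (DivRestrict S D₂)

/-- The rank computed on the subgraph `S` of `Γ`. -/
noncomputable def divRankOn {Γ : Type*} [MetricSpace Γ] (S : Set Γ) (D : Divisor Γ) : ℤ :=
  divRank ↥S (DivRestrict S D)

/-- A free divisor: effective, of rank at least one, and removing any point decreases
the rank. -/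
def IsFreeDivisor (Γ : Type*) [MetricSpace Γ] (D : Divisor Γ) : Prop :=
  Effective D ∧ 1 ≤ divRank Γ D ∧
  ∀ P : Γ, divRank Γ (D - Finsupp.single P 1) < divRank Γ D

/-- The canonical divisor `K_Γ = Σ_P (val(P) - 2)·P`. -/
def IsCanonical (Γ : Type*) [MetricSpace Γ] (K : Divisor Γ) : Prop :=
  ∀ P : Γ, K P = (valence Γ P : ℤ) - 2

/-- A very special divisor: effective with `rk(D) > 0` and `rk(K_Γ - D) > 0`. -/
def VerySpecial (Γ : Type*) [MetricSpace Γ] (D : Divisor Γ) : Prop :=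
  Effective D ∧ 0 < divRank Γ D ∧
  ∃ K : Divisor Γ, IsCanonical Γ K ∧ 0 < divRank Γ (K - D)

/-- `φ` is an `L`-periodic locally isometric parametrization of the circle `S ⊆ Γ`
of circumference `L`. -/
def CircleParam {Γ : Type*} [MetricSpace Γ] (S : Set Γ) (L : ℝ) (φ : ℝ → Γ) : Prop :=
  0 < L ∧ (∀ t : ℝ, φ (t + L) = φ t) ∧ Set.range φ = S ∧
  ∀ s t : ℝ, |s - t| ≤ L / 2 → dist (φ s) (φ t) = |s - t|

/-- `S` is a metric circle inside `Γ`. -/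
def IsCircleSet {Γ : Type*} [MetricSpace Γ] (S : Set Γ) : Prop :=
  ∃ (L : ℝ) (φ : ℝ → Γ), CircleParam S L φ

end
/-- A bundled metric graph. -/
structure MetricGraph : Type 1 where
  carrier : Type
  [ms : MetricSpace carrier]
  graph : IsMetricGraph carrier

attribute [instance] MetricGraph.ms

/-- A metric graph `G` obtained from a metric graph `G₀` by attaching a loop `γ`
(a metric circle) at a point `v ∈ G₀`. -/
structure LoopAttachment : Type 1 where
  G : Type
  [ms : MetricSpace G]
  graph : IsMetricGraph G
  G₀ : Set G
  γ : Set G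
  v : G
  hv : v ∈ G₀
  closed₀ : IsClosed G₀
  closedγ : IsClosed γ
  cover : G₀ ∪ γ = Set.univ
  meet : G₀ ∩ γ = {v}
  graph₀ : IsMetricGraph ↥G₀
  circleγ : IsCircleSet γ

attribute [instance] LoopAttachment.ms
/-- A chain of `a` loops `γ₁, …, γ_a` with consecutive loops meeting in the points
`w₁, …, w_{a-1}`, together with marked points `vg ∈ γ₁ \ {w₁}` and `vg' ∈ γ_a \ {w_{a-1}}`. -/
structure ChainOfLoops (a : ℕ) : Type 1 where
  ha : 1 ≤ a
  Γ : Type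
  [ms : MetricSpace Γ]
  graph : IsMetricGraph Γ
  loop : ℕ → Set Γ
  w : ℕ → Γ
  vg : Γ
  vg' : Γ
  circle : ∀ i ∈ Finset.Icc 1 a, IsCircleSet (loop i)
  closedLoop : ∀ i ∈ Finset.Icc 1 a, IsClosed (loop i)
  cover : (⋃ i ∈ Finset.Icc 1 a, loop i) = Set.univ
  chainMeet : ∀ i ∈ Finset.Icc 1 (a - 1), loop i ∩ loop (i + 1) = {w i}
  chainDisj : ∀ i ∈ Finset.Icc 1 a, ∀ j ∈ Finset.Icc 1 a, i + 2 ≤ j → loop i ∩ loop j = ∅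
  hvg : vg ∈ loop 1
  hvg' : vg' ∈ loop a
  hvgw : 2 ≤ a → vg ≠ w 1
  hvg'w : 2 ≤ a → vg' ≠ w (a - 1)

attribute [instance] ChainOfLoops.ms

/-- The chain-plus-loops graph: a chain `Γ₀` of `a` loops (with the genericity condition
that the two edges joining `w_i` to `w_{i+1}` have different lengths), marked points
`v_{a+1}, …, v_g` on `Γ₀` (with `v_g ∈ γ₁ \ {w₁}`, `2v_g ≁ 2w₁` on `γ₁`, and
`v_{g-1} ∈ γ_a \ {w_{a-1}}`, `2v_{g-1} ≁ 2w_{a-1}` on `γ_a`), and a loop `γ_i`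
attached at `v_i` for each `a + 1 ≤ i ≤ g`. -/
structure ChainPlusLoops (a g : ℕ) : Type 1 where
  ha : 1 ≤ a
  hg : a + 3 ≤ g
  Γ : Type
  [ms : MetricSpace Γ]
  graph : IsMetricGraph Γ
  loop : ℕ → Set Γ
  w : ℕ → Γ
  v : ℕ → Γ
  Γ₀ : Set Γ
  hΓ₀ : Γ₀ = ⋃ i ∈ Finset.Icc 1 a, loop i
  circle : ∀ i ∈ Finset.Icc 1 g, IsCircleSet (loop i)
  closedLoop : ∀ i ∈ Finset.Icc 1 g, IsClosed (loop i)
  chainMeet : ∀ i ∈ Finset.Icc 1 (a - 1), loop i ∩ loop (i + 1) = {w i}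
  chainDisj : ∀ i ∈ Finset.Icc 1 a, ∀ j ∈ Finset.Icc 1 a, i + 2 ≤ j → loop i ∩ loop j = ∅
  edgeLengths : ∀ i ∈ Finset.Icc 1 (a - 2), ∃ (L : ℝ) (φ : ℝ → Γ) (l : ℝ),
    CircleParam (loop (i + 1)) L φ ∧ φ 0 = w i ∧ 0 < l ∧ l < L ∧ φ l = w (i + 1) ∧ 2 * l ≠ L
  cover : Γ₀ ∪ (⋃ i ∈ Finset.Icc (a + 1) g, loop i) = Set.univ
  hvg : v g ∈ loop 1
  hvg' : v (g - 1) ∈ loop a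
  hvgw : 2 ≤ a → v g ≠ w 1
  hvg'w : 2 ≤ a → v (g - 1) ≠ w (a - 1)
  vgGeneric : 2 ≤ a →
    ¬ LinEquivOn (loop 1) (Finsupp.single (v g) 2) (Finsupp.single (w 1) 2)
  vg'Generic : 2 ≤ a →
    ¬ LinEquivOn (loop a) (Finsupp.single (v (g - 1)) 2) (Finsupp.single (w (a - 1)) 2)
  hvMem : ∀ i ∈ Finset.Icc (a + 1) g, v i ∈ Γ₀
  hvInj : ∀ i ∈ Finset.Icc (a + 1) g, ∀ j ∈ Finset.Icc (a + 1) g, i ≠ j → v i ≠ v j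
  hvw : ∀ i ∈ Finset.Icc (a + 1) g, ∀ k ∈ Finset.Icc 1 (a - 1), v i ≠ w k
  attachMeet : ∀ i ∈ Finset.Icc (a + 1) g, loop i ∩ Γ₀ = {v i}
  attachDisj : ∀ i ∈ Finset.Icc (a + 1) g, ∀ j ∈ Finset.Icc (a + 1) g, i ≠ j →
    loop i ∩ loop j = ∅
  graph₀ : IsMetricGraph ↥Γ₀
  hGenus : graphGenus Γ = (g : ℤ)

attribute [instance] ChainPlusLoops.ms

section Arcs

theorem ArcEquiv.symm {Γ : Type*} {σ τ : ℝ → Γ} (h : ArcEquiv σ τ) : ArcEquiv τ σ := by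
  obtain ⟨ε, hε, h⟩ := h
  exact ⟨ε, hε, fun t ht => (h t ht).symm⟩

theorem ArcEquiv.trans {Γ : Type*} {ρ σ τ : ℝ → Γ} (h : ArcEquiv ρ σ) (h' : ArcEquiv σ τ) :
    ArcEquiv ρ τ := by
  obtain ⟨ε, hε, h⟩ := h
  obtain ⟨ε', hε', h'⟩ := h'
  refine ⟨min ε ε', lt_min hε hε', fun t ht => ?_⟩
  rw [h t ⟨ht.1, ht.2.trans (min_le_left _ _)⟩, h' t ⟨ht.1, ht.2.trans (min_le_right _ _)⟩]

theorem HasSlopeAlong.congr_arc {Γ : Type*} {f : Γ → ℝ} {σ τ : ℝ → Γ} {s : ℤ}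
    (h : HasSlopeAlong f σ s) (e : ArcEquiv σ τ) : HasSlopeAlong f τ s := by
  obtain ⟨ε, hε, h⟩ := h
  obtain ⟨ε', hε', e⟩ := e
  refine ⟨min ε ε', lt_min hε hε', fun t ht => ?_⟩
  rw [← e t ⟨ht.1, ht.2.trans (min_le_right _ _)⟩, ← e 0 ⟨le_rfl, hε'.le⟩]
  exact h t ⟨ht.1, ht.2.trans (min_le_left _ _)⟩

theorem HasSlopeAlong.unique {Γ : Type*} {f : Γ → ℝ} {τ : ℝ → Γ} {s s' : ℤ}
    (h : HasSlopeAlong f τ s) (h' : HasSlopeAlong f τ s') : s = s' := by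
  obtain ⟨ε, hε, h⟩ := h
  obtain ⟨ε', hε', h'⟩ := h'
  have hm := lt_min hε hε'
  have h1 := h (min ε ε') ⟨hm.le, min_le_left _ _⟩
  have h2 := h' (min ε ε') ⟨hm.le, min_le_right _ _⟩
  have : (s : ℝ) * min ε ε' = s' * min ε ε' := by linarith
  exact_mod_cast mul_right_cancel₀ hm.ne' this

theorem HasSlopeAlong.add {Γ : Type*} {f f' : Γ → ℝ} {τ : ℝ → Γ} {s s' : ℤ}
    (h : HasSlopeAlong f τ s) (h' : HasSlopeAlong f' τ s') :
    HasSlopeAlong (fun x => f x + f' x) τ (s + s') := by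
  obtain ⟨ε, hε, h⟩ := h
  obtain ⟨ε', hε', h'⟩ := h'
  refine ⟨min ε ε', lt_min hε hε', fun t ht => ?_⟩
  have h1 := h t ⟨ht.1, ht.2.trans (min_le_left _ _)⟩
  have h2 := h' t ⟨ht.1, ht.2.trans (min_le_right _ _)⟩
  push_cast
  linarith

theorem HasSlopeAlong.neg {Γ : Type*} {f : Γ → ℝ} {τ : ℝ → Γ} {s : ℤ}
    (h : HasSlopeAlong f τ s) : HasSlopeAlong (fun x => -f x) τ (-s) := by
  obtain ⟨ε, hε, h⟩ := h
  refine ⟨ε, hε, fun t ht => ?_⟩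
  have h1 := h t ht
  push_cast
  linarith

/-- A family of arcs representing every tangent direction at `P` exactly once. -/
structure IsArcSystem {Γ : Type*} [MetricSpace Γ] (P : Γ) {κ : Type*} (τ : κ → ℝ → Γ) :
    Prop where
  isArcAt : ∀ k, IsArcAt P (τ k)
  pairwise : Pairwise fun k l => ¬ ArcEquiv (τ k) (τ l)
  complete : ∀ σ : ℝ → Γ, IsArcAt P σ → ∃ k, ArcEquiv σ (τ k)

theorem IsArcSystem.eq_of_arcEquiv {Γ : Type*} [MetricSpace Γ] {P : Γ} {κ : Type*}
    {τ : κ → ℝ → Γ} (h : IsArcSystem P τ) {k l : κ} (e : ArcEquiv (τ k) (τ l)) : k = l := by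
  by_contra hne
  exact h.pairwise hne e

theorem IsArcSystem.exists_equiv {Γ : Type*} [MetricSpace Γ] {P : Γ} {κ κ' : Type*}
    {τ : κ → ℝ → Γ} {τ' : κ' → ℝ → Γ} (h : IsArcSystem P τ) (h' : IsArcSystem P τ') :
    ∃ e : κ ≃ κ', ∀ k, ArcEquiv (τ k) (τ' (e k)) := by
  choose e he using fun k => h'.complete (τ k) (h.isArcAt k)
  choose d hd using fun k => h.complete (τ' k) (h'.isArcAt k)
  exact ⟨⟨e, d, fun k => (h.eq_of_arcEquiv ((he k).trans (hd _))).symm,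
    fun k => (h'.eq_of_arcEquiv ((hd k).trans (he _))).symm⟩, he⟩

/-- The order of a function at a point can be computed with any arc system. -/
theorem IsArcSystem.hasOrderAt_iff {Γ : Type*} [MetricSpace Γ] {P : Γ} {κ : Type*} [Fintype κ]
    {τ : κ → ℝ → Γ} (h : IsArcSystem P τ) {f : Γ → ℝ} {m : ℤ} :
    HasOrderAt Γ f P m ↔
      ∃ s : κ → ℤ, (∀ k, HasSlopeAlong f (τ k) (s k)) ∧ m = ∑ k, s k := by
  constructor
  · rintro ⟨n, τ', s, h1, h2, h3, h4, rfl⟩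
    obtain ⟨e, he⟩ := h.exists_equiv (⟨h1, h2, h3⟩ : IsArcSystem P τ')
    exact ⟨fun k => s (e k), fun k => (h4 _).congr_arc (he k).symm,
      (Equiv.sum_comp e s).symm⟩
  · rintro ⟨s, hs, rfl⟩
    let e := Fintype.equivFin κ
    refine ⟨_, fun n => τ (e.symm n), fun n => s (e.symm n), fun n => h.isArcAt _,
      fun i j hij => h.pairwise (e.symm.injective.ne hij), fun σ hσ => ?_, fun n => hs _,
      (Equiv.sum_comp e.symm s).symm⟩
    obtain ⟨k, hk⟩ := h.complete σ hσ
    exact ⟨e k, by simpa using hk⟩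

theorem HasOrderAt.add {Γ : Type*} [MetricSpace Γ] {f f' : Γ → ℝ} {P : Γ} {m m' : ℤ}
    (h : HasOrderAt Γ f P m) (h' : HasOrderAt Γ f' P m') :
    HasOrderAt Γ (fun x => f x + f' x) P (m + m') := by
  obtain ⟨n, τ, s, h1, h2, h3, h4, rfl⟩ := h
  have hτ : IsArcSystem P τ := ⟨h1, h2, h3⟩
  obtain ⟨s', h5, rfl⟩ := hτ.hasOrderAt_iff.1 h'
  exact hτ.hasOrderAt_iff.2
    ⟨fun k => s k + s' k, fun k => (h4 k).add (h5 k), Finset.sum_add_distrib.symm⟩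

theorem HasOrderAt.neg {Γ : Type*} [MetricSpace Γ] {f : Γ → ℝ} {P : Γ} {m : ℤ}
    (h : HasOrderAt Γ f P m) : HasOrderAt Γ (fun x => -f x) P (-m) := by
  obtain ⟨n, τ, s, h1, h2, h3, h4, rfl⟩ := h
  exact ⟨n, τ, fun k => -s k, h1, h2, h3, fun k => (h4 k).neg, by simp⟩

theorem IsRational.add {Γ : Type*} [MetricSpace Γ] {f f' : Γ → ℝ}
    (h : IsRational Γ f) (h' : IsRational Γ f') : IsRational Γ fun x => f x + f' x := by
  refine ⟨h.1.add h'.1, fun P τ hτ => ?_⟩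
  obtain ⟨s, hs⟩ := h.2 P τ hτ
  obtain ⟨s', hs'⟩ := h'.2 P τ hτ
  exact ⟨_, hs.add hs'⟩

theorem IsRational.neg {Γ : Type*} [MetricSpace Γ] {f : Γ → ℝ}
    (h : IsRational Γ f) : IsRational Γ fun x => -f x := by
  refine ⟨h.1.neg, fun P τ hτ => ?_⟩
  obtain ⟨s, hs⟩ := h.2 P τ hτ
  exact ⟨_, hs.neg⟩

end Arcs

section Jumps

/-- The ray in `ℝ` from `t` pointing to the right (`b = true`) or to the left. -/
def realRay (t : ℝ) (b : Bool) (u : ℝ) : ℝ := t + if b then u else -u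

/-- The two outgoing slopes of `h` at `t` are integers with sum `m`. -/
def HasJump (h : ℝ → ℝ) (t : ℝ) (m : ℤ) : Prop :=
  ∃ s : Bool → ℤ, (∀ b, HasSlopeAlong h (realRay t b) (s b)) ∧ m = s true + s false

theorem HasJump.add {h h' : ℝ → ℝ} {t : ℝ} {m m' : ℤ} (H : HasJump h t m)
    (H' : HasJump h' t m') : HasJump (fun x => h x + h' x) t (m + m') := by
  obtain ⟨s, hs, rfl⟩ := H
  obtain ⟨s', hs', rfl⟩ := H'
  exact ⟨fun b => s b + s' b, fun b => (hs b).add (hs' b), by ring⟩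

theorem HasJump.neg {h : ℝ → ℝ} {t : ℝ} {m : ℤ} (H : HasJump h t m) :
    HasJump (fun x => -h x) t (-m) := by
  obtain ⟨s, hs, rfl⟩ := H
  exact ⟨fun b => -s b, fun b => (hs b).neg, by ring⟩

theorem HasJump.sub {h h' : ℝ → ℝ} {t : ℝ} {m m' : ℤ} (H : HasJump h t m)
    (H' : HasJump h' t m') : HasJump (fun x => h x - h' x) t (m - m') := by
  simpa only [sub_eq_add_neg] using H.add H'.neg

theorem HasJump.congr {h h' : ℝ → ℝ} {t : ℝ} {m : ℤ} (H : HasJump h t m) {a b : ℝ}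
    (hat : a < t) (htb : t < b) (e : ∀ z, a < z → z < b → h z = h' z) : HasJump h' t m := by
  obtain ⟨s, hs, rfl⟩ := H
  refine ⟨s, fun β => ?_, rfl⟩
  obtain ⟨ε, hε, H⟩ := hs β
  have hm : 0 < min (t - a) (b - t) / 2 := half_pos (lt_min (by linarith) (by linarith))
  refine ⟨min ε (min (t - a) (b - t) / 2), lt_min hε hm, fun u hu => ?_⟩
  have h1 := hu.2.trans (min_le_right _ _)
  have h2 := min_le_left (t - a) (b - t)
  have h3 := min_le_right (t - a) (b - t)
  have h0 := hu.1
  have key := H u ⟨hu.1, hu.2.trans (min_le_left _ _)⟩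
  rwa [e, e] at key
  all_goals cases β <;> simp [realRay] <;> linarith

theorem HasJump.periodic {h : ℝ → ℝ} {L t : ℝ} {m : ℤ} (hL : Function.Periodic h L)
    (H : HasJump h t m) (k : ℤ) : HasJump h (t + k * L) m := by
  obtain ⟨s, hs, rfl⟩ := H
  refine ⟨s, fun b => ?_, rfl⟩
  obtain ⟨ε, hε, H⟩ := hs b
  refine ⟨ε, hε, fun u hu => ?_⟩
  have e : ∀ u, h (realRay (t + k * L) b u) = h (realRay t b u) := fun u => by
    rw [← (hL.int_mul k) (realRay t b u)]
    congr 1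
    simp only [realRay]
    ring
  rw [e, e]
  exact H u hu

theorem hasJump_const (c t : ℝ) : HasJump (fun _ => c) t 0 :=
  ⟨fun _ => 0, fun _ => ⟨1, one_pos, by simp⟩, by simp⟩

theorem hasJump_ramp (c t : ℝ) : HasJump (fun z => max (z - c) 0) t (if t = c then 1 else 0) := by
  rcases lt_trichotomy t c with h | h | h
  · rw [if_neg h.ne]
    refine (hasJump_const 0 t).congr (sub_one_lt t) h fun z _ hz => ?_
    rw [max_eq_right (by linarith)]
  · subst h
    refine ⟨fun b => if b then 1 else 0, fun b => ⟨1, one_pos, fun u hu => ?_⟩, by simp⟩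
    have := hu.1
    cases b <;> simp [realRay, hu.1]
  · rw [if_neg h.ne']
    refine HasJump.congr (h := fun z => z - c)
      ⟨fun b => if b then 1 else -1, fun b => ⟨1, one_pos, fun u hu => ?_⟩, by simp⟩
      h (lt_add_one t) fun z hz _ => ?_
    · cases b <;> simp [realRay] <;> ring
    · rw [max_eq_left (by linarith)]

end Jumps

section CircleDegree

theorem HasSlopeAlong.exists_near {h : ℝ → ℝ} {t : ℝ} {b : Bool} {s : ℤ}
    (H : HasSlopeAlong h (realRay t b) s) :
    ∃ ε > 0, ∀ u, 0 < u → u < ε →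
      HasSlopeAlong h (realRay (realRay t b u) b) s ∧
      HasSlopeAlong h (realRay (realRay t b u) !b) (-s) := by
  obtain ⟨ε, hε, H⟩ := H
  refine ⟨ε, hε, fun u hu huε => ⟨⟨ε - u, by linarith, fun v hv => ?_⟩,
    ⟨u, hu, fun v hv => ?_⟩⟩⟩
  · have e : ∀ v, realRay (realRay t b u) b v = realRay t b (u + v) := fun v => by
      cases b <;> simp [realRay] <;> ring
    have h0 := hv.1
    have h1 := hv.2
    rw [e, e, H _ ⟨by linarith, by linarith⟩, H (u + 0) ⟨by linarith, by linarith⟩]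
    ring
  · have e : ∀ v, realRay (realRay t b u) (!b) v = realRay t b (u - v) := fun v => by
      cases b <;> simp [realRay] <;> ring
    have h0 := hv.1
    have h1 := hv.2
    rw [e, e, H _ ⟨by linarith, by linarith⟩, H (u - 0) ⟨by linarith, by linarith⟩]
    push_cast
    ring

/-- The jumps of a periodic piecewise affine function add up to zero over a period. -/
theorem sum_jump_eq_zero {h : ℝ → ℝ} {L : ℝ} (hL : 0 < L) (hper : Function.Periodic h L)
    {J : ℝ → ℤ} (hJ : ∀ t, HasJump h t (J t)) :
    (Set.Ico 0 L ∩ Function.support J).Finite ∧ ∑ᶠ t ∈ Set.Ico 0 L, J t = 0 := by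
  choose s hs hsJ using hJ
  have near : ∀ x, ∃ ε > 0, ∀ b u, 0 < u → u < ε →
      s (realRay x b u) b = s x b ∧ s (realRay x b u) (!b) = -s x b := by
    intro x
    choose ε hε H using fun b => (hs x b).exists_near
    refine ⟨min (ε true) (ε false), lt_min (hε _) (hε _), fun b u hu hu' => ?_⟩
    have hb : u < ε b := by
      cases b
      · exact hu'.trans_le (min_le_right _ _)
      · exact hu'.trans_le (min_le_left _ _)
    exact ⟨(hs _ _).unique (H b u hu hb).1, (hs _ _).unique (H b u hu hb).2⟩
  choose ε hε hnear using near
  have right : ∀ x y, x < y → y < x + ε x → s y false = -s x true ∧ J y = 0 := by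
    intro x y h1 h2
    have := hnear x true (y - x) (by linarith) (by linarith)
    have e : realRay x true (y - x) = y := by simp [realRay]
    rw [e] at this
    refine ⟨this.2, ?_⟩
    rw [hsJ, this.1]
    simpa using congrArg (s x true + ·) this.2
  have left : ∀ x y, x - ε x < y → y < x → s y false = s x false ∧ J y = 0 := by
    intro x y h1 h2
    have := hnear x false (x - y) (by linarith) (by linarith)
    have e : realRay x false (x - y) = y := by simp [realRay]
    rw [e] at this
    refine ⟨this.1, ?_⟩
    rw [hsJ, this.1]
    simpa using congrArg (· + s x false) this.2
  have hfin : (Set.Icc 0 L ∩ Function.support J).Finite := by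
    obtain ⟨T, -, hT⟩ := (isCompact_Icc (a := (0 : ℝ)) (b := L)).elim_nhds_subcover
      (fun x => Set.Ioo (x - ε x) (x + ε x))
      fun x _ => Ioo_mem_nhds (by linarith [hε x]) (by linarith [hε x])
    refine T.finite_toSet.subset fun y hy => ?_
    obtain ⟨x, hx, hxy⟩ := Set.mem_iUnion₂.1 (hT hy.1)
    rcases lt_trichotomy x y with h | h | h
    · exact absurd (right x y h hxy.2).2 hy.2
    · exact h ▸ hx
    · exact absurd (left x y hxy.1 h).2 hy.2
  have hfin' : (Set.Ico 0 L ∩ Function.support J).Finite :=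
    hfin.subset (Set.inter_subset_inter_left _ Set.Ico_subset_Icc_self)
  refine ⟨hfin', ?_⟩
  set T := hfin.toFinset with hTdef
  have hTJ : ∀ x ∈ Set.Icc 0 L, ∑ t ∈ T, (if t = x then J x else 0) = J x := by
    intro x hx
    rw [Finset.sum_ite_eq']
    split_ifs with hxT
    · rfl
    · by_contra hne
      exact hxT (hfin.mem_toFinset.2 ⟨hx, Ne.symm hne⟩)
  let c : ℝ → ℤ := fun y => ∑ t ∈ T, (if t < y then J t else 0) + s y false
  have hc : ContinuousOn c (Set.Icc 0 L) := by
    intro x hx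
    have : ∀ᶠ y in nhdsWithin x (Set.Icc 0 L), c y = c x := by
      filter_upwards [mem_nhdsWithin_of_mem_nhds (Ioo_mem_nhds
        (show x - ε x < x by linarith [hε x]) (show x < x + ε x by linarith [hε x]))] with y hy
      rcases lt_trichotomy x y with h | h | h
      · have hsum : ∑ t ∈ T, (if t < y then J t else 0) =
            ∑ t ∈ T, (if t < x then J t else 0) + J x := by
          conv_rhs => rw [← hTJ x hx]
          rw [← Finset.sum_add_distrib]
          refine Finset.sum_congr rfl fun t ht => ?_
          rcases lt_trichotomy t x with h' | h' | h'
          · simp [h', h'.trans h, h'.ne]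
          · simp [h', h]
          · have h3 : ¬ t < y := fun h3 =>
              (hfin.mem_toFinset.1 ht).2 (right x t h' (h3.trans hy.2)).2
            simp [h3, h'.ne', not_lt.2 h'.le]
        simp only [c, hsum, (right x y h hy.2).1, hsJ x]
        ring
      · rw [h]
      · have hsum : ∑ t ∈ T, (if t < y then J t else 0) =
            ∑ t ∈ T, (if t < x then J t else 0) := by
          refine Finset.sum_congr rfl fun t ht => ?_
          by_cases h' : t < y
          · simp [h', h'.trans h]
          · by_cases h3 : t < x
            · rcases (not_lt.1 h').lt_or_eq with h4 | h4
              · exact absurd (left x t (hy.1.trans h4) h3).2 (hfin.mem_toFinset.1 ht).2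
              · exact absurd (left x t (h4 ▸ hy.1) h3).2 (hfin.mem_toFinset.1 ht).2
            · simp [h', h3]
        simp only [c, hsum, (left x y hy.1 h).1]
    exact tendsto_nhds_of_eventually_eq this
  have hconst : c L = c 0 :=
    isPreconnected_Icc.constant hc ⟨hL.le, le_rfl⟩ ⟨le_rfl, hL.le⟩
  have hs0 : s L false = s 0 false := by
    refine (hs L false).unique ?_
    obtain ⟨δ, hδ, H⟩ := hs 0 false
    refine ⟨δ, hδ, fun u hu => ?_⟩
    have e : ∀ u, h (realRay L false u) = h (realRay 0 false u) := fun u => by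
      rw [← hper (realRay 0 false u)]
      congr 1
      simp only [realRay]
      ring
    rw [e, e]
    exact H u hu
  have h0 : ∑ t ∈ T, (if t < 0 then J t else 0) = 0 :=
    Finset.sum_eq_zero fun t ht => if_neg (not_lt.2 (hfin.mem_toFinset.1 ht).1.1)
  have hsum : ∑ t ∈ T, (if t < L then J t else 0) = 0 := by
    simp only [c, h0, hs0] at hconst
    linarith
  rw [finsum_mem_eq_sum_of_inter_support_eq (t := T.filter (· < L)), Finset.sum_filter, hsum]
  ext t
  simp only [Set.mem_inter_iff, Set.mem_Ico, Function.mem_support, Finset.coe_filter,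
    Set.mem_ofPred_eq, hTdef, Set.Finite.mem_toFinset, Set.mem_Icc]
  constructor
  · rintro ⟨⟨h1, h2⟩, h3⟩
    exact ⟨⟨⟨⟨h1, h2.le⟩, h3⟩, h2⟩, h3⟩
  · rintro ⟨⟨⟨⟨h1, -⟩, -⟩, h2⟩, h3⟩
    exact ⟨⟨h1, h2⟩, h3⟩

end CircleDegree

section CircleParam

variable {Γ : Type*} [MetricSpace Γ] {S : Set Γ} {L : ℝ} {φ : ℝ → Γ}

theorem CircleParam.mem (h : CircleParam S L φ) (t : ℝ) : φ t ∈ S :=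
  h.2.2.1 ▸ Set.mem_range_self t

theorem CircleParam.periodic (h : CircleParam S L φ) : Function.Periodic φ L := h.2.1

theorem CircleParam.exists_mem_Ico (h : CircleParam S L φ) (a : ℝ) {x : Γ} (hx : x ∈ S) :
    ∃ t ∈ Set.Ico a (a + L), φ t = x := by
  obtain ⟨t, rfl⟩ : x ∈ Set.range φ := h.2.2.1.symm ▸ hx
  obtain ⟨y, hy, e⟩ := h.periodic.exists_mem_Ico h.1 t a
  exact ⟨y, hy, e.symm⟩

theorem CircleParam.injOn (h : CircleParam S L φ) (a : ℝ) : Set.InjOn φ (Set.Ico a (a + L)) := by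
  have key : ∀ s t, s ≤ t → t < s + L → φ s = φ t → s = t := by
    intro s t hst htL e
    by_cases hle : t - s ≤ L / 2
    · have := h.2.2.2 s t (by rw [abs_sub_comm, abs_of_nonneg (by linarith)]; exact hle)
      rw [e, dist_self, eq_comm, abs_eq_zero] at this
      linarith
    · have := h.2.2.2 (s + L) t (by rw [abs_of_nonneg] <;> linarith)
      rw [h.2.1, e, dist_self, eq_comm, abs_eq_zero] at this
      linarith
  intro s hs t ht e
  rcases le_total s t with hst | hst
  · exact key s t hst (by linarith [hs.1, ht.2]) e
  · exact (key t s hst (by linarith [hs.2, ht.1]) e.symm).symm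

/-- Points near `φ t` on the circle lie on one of the two rays at their distance. -/
theorem CircleParam.exists_realRay (h : CircleParam S L φ) (t : ℝ) {x : Γ} (hx : x ∈ S) :
    ∃ b, x = φ (realRay t b (dist x (φ t))) := by
  obtain ⟨z, hz, rfl⟩ := h.exists_mem_Ico (t - L / 2) hx
  have hd := h.2.2.2 z t (by rw [abs_le]; constructor <;> linarith [hz.1, hz.2])
  rw [hd]
  rcases le_total t z with hle | hle
  · refine ⟨true, ?_⟩
    rw [abs_of_nonneg (by linarith)]
    simp [realRay]
  · refine ⟨false, ?_⟩
    rw [abs_of_nonpos (by linarith)]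
    simp [realRay]

theorem CircleParam.isArcAt (h : CircleParam S L φ) (t : ℝ) (b : Bool) :
    IsArcAt (φ t) fun u => φ (realRay t b u) := by
  refine ⟨by cases b <;> simp [realRay], L / 2, half_pos h.1, fun u hu v hv => ?_⟩
  have habs : |realRay t b u - realRay t b v| = |u - v| := by
    cases b
    · rw [abs_sub_comm u v]
      simp only [realRay]
      congr 1
      simp
      ring
    · simp [realRay]
  rw [h.2.2.2 _ _ (by rw [habs, abs_le]; constructor <;> linarith [hu.1, hu.2, hv.1, hv.2]), habs]

end CircleParam

theorem IsArcAt.exists_dist {Γ : Type*} [MetricSpace Γ] {P : Γ} {σ : ℝ → Γ} (h : IsArcAt P σ) :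
    ∃ a > 0, (∀ u ∈ Set.Icc 0 a, dist (σ u) P = u) ∧
      ∀ s ∈ Set.Icc 0 a, ∀ t ∈ Set.Icc 0 a, dist (σ s) (σ t) = |s - t| := by
  obtain ⟨h0, a, ha, h⟩ := h
  refine ⟨a, ha, fun u hu => ?_, h⟩
  rw [← h0, h u hu 0 ⟨le_rfl, ha.le⟩, sub_zero, abs_of_nonneg hu.1]

theorem IsArcAt.continuousOn {Γ : Type*} [MetricSpace Γ] {σ : ℝ → Γ} {a : ℝ}
    (h : ∀ s ∈ Set.Icc 0 a, ∀ t ∈ Set.Icc 0 a, dist (σ s) (σ t) = |s - t|) :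
    ContinuousOn σ (Set.Icc 0 a) := by
  refine LipschitzOnWith.continuousOn (K := 1) (LipschitzOnWith.of_dist_le_mul fun s hs t ht => ?_)
  rw [h s hs t ht, Real.dist_eq]
  simp

/-- A metric space covered by circles any two of which meet in at most one point, together with
a retraction to each circle which is constant on each of the others. -/
structure Cactus (Γ : Type*) [MetricSpace Γ] (ι : Type*) where
  S : ι → Set Γ
  L : ι → ℝ
  φ : ι → ℝ → Γ
  circle : ∀ i, CircleParam (S i) (L i) (φ i)
  closed : ∀ i, IsClosed (S i)
  cover : ∀ x, ∃ i, x ∈ S i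
  meet : ∀ i j, i ≠ j → (S i ∩ S j).Subsingleton
  retr : ι → Γ → Γ
  retr_self : ∀ i, ∀ x ∈ S i, retr i x = x
  retr_const : ∀ i j, i ≠ j → ∀ x ∈ S j, ∀ y ∈ S j, retr i x = retr i y

namespace Cactus

variable {Γ : Type*} [MetricSpace Γ] {ι : Type*} (C : Cactus Γ ι)

/-- The coordinate of `P` on the circle `S i`. -/
noncomputable def coord (i : ι) (P : Γ) : ℝ :=
  open Classical in
  if h : P ∈ C.S i then ((C.circle i).exists_mem_Ico 0 h).choose else 0

theorem coord_spec {i : ι} {P : Γ} (h : P ∈ C.S i) :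
    C.coord i P ∈ Set.Ico 0 (C.L i) ∧ C.φ i (C.coord i P) = P := by
  have := ((C.circle i).exists_mem_Ico 0 h).choose_spec
  rw [coord, dif_pos h]
  simpa using this

/-- The arcs at `P` along the circles through `P`. -/
noncomputable def arc (P : Γ) (k : {i // P ∈ C.S i} × Bool) (u : ℝ) : Γ :=
  C.φ k.1 (realRay (C.coord k.1 P) k.2 u)

theorem isArcAt_arc (P : Γ) (k : {i // P ∈ C.S i} × Bool) : IsArcAt P (C.arc P k) := by
  have := (C.circle k.1).isArcAt (C.coord k.1 P) k.2
  rwa [(C.coord_spec k.1.2).2] at this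

theorem arc_mem (P : Γ) (k : {i // P ∈ C.S i} × Bool) (u : ℝ) : C.arc P k u ∈ C.S k.1 :=
  (C.circle k.1).mem _

variable [Finite ι]

/-- Near `P` there are only points of circles through `P`. -/
theorem exists_local (P : Γ) :
    ∃ ε > 0, ∀ x, dist x P < ε → ∀ i, x ∈ C.S i → P ∈ C.S i := by
  have : ∀ᶠ x in nhds P, ∀ i, x ∈ C.S i → P ∈ C.S i := by
    rw [Filter.eventually_all]
    intro i
    by_cases h : P ∈ C.S i
    · exact Filter.Eventually.of_forall fun _ _ => h
    · filter_upwards [(C.closed i).isOpen_compl.mem_nhds h] with x hx hx'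
      exact absurd hx' hx
  obtain ⟨ε, hε, H⟩ := Metric.eventually_nhds_iff.1 this
  exact ⟨ε, hε, fun x hx => H hx⟩

theorem exists_eq_arc (P : Γ) :
    ∃ ε > 0, ∀ x, dist x P < ε → ∃ k, x = C.arc P k (dist x P) := by
  obtain ⟨ε, hε, H⟩ := C.exists_local P
  refine ⟨ε, hε, fun x hx => ?_⟩
  obtain ⟨i, hi⟩ := C.cover x
  have hP := H x hx i hi
  obtain ⟨b, hb⟩ := (C.circle i).exists_realRay (C.coord i P) hi
  rw [(C.coord_spec hP).2] at hb
  exact ⟨(⟨i, hP⟩, b), hb⟩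

theorem arc_complete (P : Γ) {σ : ℝ → Γ} (hσ : IsArcAt P σ) :
    ∃ k, ArcEquiv σ (C.arc P k) := by
  obtain ⟨a, ha, hdP, hd⟩ := hσ.exists_dist
  obtain ⟨ε, hε, hloc⟩ := C.exists_local P
  have hpos : 0 < min a (ε / 2) := lt_min ha (half_pos hε)
  set c := min a (ε / 2) with hc
  have hca : c ≤ a := min_le_left _ _
  have hcε : c < ε := (min_le_right _ _).trans_lt (by linarith)
  have hdc : ∀ u ∈ Set.Ioc 0 c, dist (σ u) P = u := fun u hu =>
    hdP u ⟨hu.1.le, hu.2.trans hca⟩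
  have hne : ∀ u ∈ Set.Ioc 0 c, σ u ≠ P := fun u hu e => by
    have := hdc u hu
    rw [e, dist_self] at this
    exact hu.1.ne this
  have hcmem : c ∈ Set.Ioc 0 c := ⟨hpos, le_rfl⟩
  obtain ⟨i, hi⟩ := C.cover (σ c)
  have hPS : ∀ u ∈ Set.Ioc 0 c, ∀ j, σ u ∈ C.S j → P ∈ C.S j := fun u hu =>
    hloc _ (by rw [hdc u hu]; exact hu.2.trans_lt hcε)
  have hPi : P ∈ C.S i := hPS c hcmem i hi
  have hall : ∀ u ∈ Set.Ioc 0 c, σ u ∈ C.S i := by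
    by_contra! hcon
    obtain ⟨u, hu, hui⟩ := hcon
    have hpre : IsPreconnected (σ '' Set.Ioc 0 c) :=
      isPreconnected_Ioc.image σ ((IsArcAt.continuousOn hd).mono fun v hv =>
        ⟨hv.1.le, hv.2.trans hca⟩)
    have hclosed : IsClosed (⋃ j : {j // j ≠ i}, C.S j) :=
      isClosed_iUnion_of_finite fun j => C.closed j
    obtain ⟨x, ⟨v, hv, rfl⟩, hx1, hx2⟩ := isPreconnected_closed_iff.1 hpre _ _ (C.closed i) hclosed
      (fun x _ => by
        obtain ⟨j, hj⟩ := C.cover x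
        by_cases hji : j = i
        · exact Or.inl (hji ▸ hj)
        · exact Or.inr (Set.mem_iUnion.2 ⟨⟨j, hji⟩, hj⟩))
      ⟨σ c, ⟨c, hcmem, rfl⟩, hi⟩
      ⟨σ u, ⟨u, hu, rfl⟩, by
        obtain ⟨j, hj⟩ := C.cover (σ u)
        exact Set.mem_iUnion.2 ⟨⟨j, fun hji => hui (hji ▸ hj)⟩, hj⟩⟩
    obtain ⟨⟨j, hji⟩, hj⟩ := Set.mem_iUnion.1 hx2
    exact hne v hv (C.meet i j (Ne.symm hji) ⟨hx1, hj⟩ ⟨hPi, hPS v hv j hj⟩)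
  set t := C.coord i P with ht
  have htP : C.φ i t = P := (C.coord_spec hPi).2
  have hL := (C.circle i).1
  have hδ : 0 < min c (C.L i / 4) := lt_min hpos (by linarith)
  set δ := min c (C.L i / 4) with hδdef
  have hδc : δ ≤ c := min_le_left _ _
  have hδL : δ ≤ C.L i / 4 := min_le_right _ _
  have hray : ∀ u ∈ Set.Ioc 0 c, ∃ b, σ u = C.φ i (realRay t b u) := fun u hu => by
    obtain ⟨b, hb⟩ := (C.circle i).exists_realRay t (hall u hu)
    rw [htP, hdc u hu] at hb
    exact ⟨b, hb⟩
  obtain ⟨b, hb⟩ := hray δ ⟨hδ, hδc⟩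
  refine ⟨(⟨i, hPi⟩, b), δ, hδ, fun u hu => ?_⟩
  rcases hu.1.eq_or_lt with h0 | h0
  · rw [← h0, hσ.1, (C.isArcAt_arc P _).1]
  obtain ⟨b', hb'⟩ := hray u ⟨h0, hu.2.trans hδc⟩
  by_cases hbb : b' = b
  · rw [hb', hbb]
    rfl
  exfalso
  have h1 := hd δ ⟨hδ.le, hδc.trans hca⟩ u ⟨h0.le, hu.2.trans (hδc.trans hca)⟩
  have habs : |realRay t b δ - realRay t b' u| = δ + u := by
    cases b <;> cases b' <;> simp [realRay] at hbb ⊢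
    · rw [abs_of_nonpos] <;> linarith [hu.2]
    · linarith [hu.2]
  rw [hb, hb', (C.circle i).2.2.2 _ _ (by rw [habs]; linarith [hu.2]), habs,
    abs_of_nonneg (by linarith [hu.2])] at h1
  linarith

theorem isArcSystem_arc (P : Γ) : IsArcSystem P (C.arc P) where
  isArcAt := C.isArcAt_arc P
  complete _ := C.arc_complete P
  pairwise := by
    rintro ⟨⟨i, hi⟩, b⟩ ⟨⟨j, hj⟩, b'⟩ hne ⟨ε, hε, H⟩
    obtain ⟨a, ha, hdP, -⟩ := (C.isArcAt_arc P (⟨i, hi⟩, b)).exists_dist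
    by_cases hij : i = j
    · subst hij
      have hbb : b ≠ b' := fun h => hne (by rw [h])
      have hL := (C.circle i).1
      set u := min ε (C.L i / 4) with hu
      have hu0 : 0 < u := lt_min hε (by linarith)
      have huL : u ≤ C.L i / 4 := min_le_right _ _
      have e := H u ⟨hu0.le, min_le_left _ _⟩
      set t := C.coord i P
      change C.φ i (realRay t b u) = C.φ i (realRay t b' u) at e
      have habs : |realRay t b u - realRay t b' u| = 2 * u := by
        cases b <;> cases b' <;> simp [realRay] at hbb ⊢
        · rw [abs_of_nonpos] <;> linarith
        · rw [abs_of_nonneg] <;> linarith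
      have h1 := (C.circle i).2.2.2 (realRay t b u) (realRay t b' u) (by rw [habs]; linarith)
      rw [e, dist_self, habs] at h1
      linarith
    · have hm := lt_min ha hε
      have e := H (min a ε) ⟨hm.le, min_le_right _ _⟩
      have h1 := hdP (min a ε) ⟨hm.le, min_le_left _ _⟩
      have : C.arc P (⟨i, hi⟩, b) (min a ε) = P := by
        refine C.meet i j hij ⟨C.arc_mem P (⟨i, hi⟩, b) _, ?_⟩ ⟨hi, hj⟩
        rw [e]
        exact C.arc_mem P (⟨j, hj⟩, b') _
      rw [this, dist_self] at h1
      exact hm.ne h1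

end Cactus

/-- The divisors of rational functions. -/
def IsPrincipal (Γ : Type*) [MetricSpace Γ] (D : Divisor Γ) : Prop :=
  ∃ f : Γ → ℝ, IsRational Γ f ∧ ∀ P : Γ, HasOrderAt Γ f P (D P)

theorem IsPrincipal.add {Γ : Type*} [MetricSpace Γ] {D D' : Divisor Γ} (h : IsPrincipal Γ D)
    (h' : IsPrincipal Γ D') : IsPrincipal Γ (D + D') := by
  obtain ⟨f, hf, hD⟩ := h
  obtain ⟨f', hf', hD'⟩ := h'
  exact ⟨_, hf.add hf', fun P => (hD P).add (hD' P)⟩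

theorem IsPrincipal.neg {Γ : Type*} [MetricSpace Γ] {D : Divisor Γ} (h : IsPrincipal Γ D) :
    IsPrincipal Γ (-D) := by
  obtain ⟨f, hf, hD⟩ := h
  exact ⟨_, hf.neg, fun P => (hD P).neg⟩

namespace Cactus

variable {Γ : Type*} [MetricSpace Γ] {ι : Type*} (C : Cactus Γ ι)

/-- The contribution of each circle to the order of a function at `P`. -/
noncomputable def jumpAt (J : ι → ℝ → ℤ) (i : ι) (P : Γ) : ℤ :=
  open Classical in if P ∈ C.S i then J i (C.coord i P) else 0

theorem exists_hasJump {f : Γ → ℝ} (hf : IsRational Γ f) :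
    ∃ J : ι → ℝ → ℤ, ∀ i t, HasJump (fun z => f (C.φ i z)) t (J i t) := by
  choose s hs using fun i t b => hf.2 _ _ ((C.circle i).isArcAt t b)
  exact ⟨fun i t => s i t true + s i t false, fun i t => ⟨s i t, hs i t, rfl⟩⟩

theorem finsum_jumpAt {J : ι → ℝ → ℤ} {f : Γ → ℝ}
    (hJ : ∀ i t, HasJump (fun z => f (C.φ i z)) t (J i t)) (i : ι) :
    (Function.support (C.jumpAt J i)).Finite ∧ ∑ᶠ P, C.jumpAt J i P = 0 := by
  obtain ⟨h1, h2⟩ := sum_jump_eq_zero (C.circle i).1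
    (fun z => congrArg f ((C.circle i).periodic z)) (hJ i)
  have hsub : Function.support (C.jumpAt J i) ⊆ C.S i := fun P hP => by
    by_contra hPS
    exact hP (if_neg hPS)
  have hinv : ∀ t ∈ Set.Ico 0 (C.L i), C.coord i (C.φ i t) = t := fun t ht => by
    have := C.coord_spec ((C.circle i).mem t)
    refine (C.circle i).injOn 0 ?_ ?_ this.2
    · simpa using this.1
    · simpa using ht
  have hval : ∀ t ∈ Set.Ico 0 (C.L i), C.jumpAt J i (C.φ i t) = J i t := fun t ht => by
    rw [jumpAt, if_pos ((C.circle i).mem t), hinv t ht]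
  have himage : C.φ i '' Set.Ico 0 (C.L i) = C.S i := by
    ext P
    constructor
    · rintro ⟨t, -, rfl⟩
      exact (C.circle i).mem t
    · intro hP
      exact ⟨_, C.coord_spec hP⟩
  constructor
  · refine (h1.image (C.φ i)).subset fun P hP => ?_
    have hPS := C.coord_spec (hsub hP)
    refine ⟨C.coord i P, ⟨hPS.1, fun h0 => hP ?_⟩, hPS.2⟩
    rw [jumpAt, if_pos (hsub hP), h0]
  · rw [← finsum_mem_univ, ← finsum_mem_inter_support, Set.univ_inter,
      ← Set.inter_eq_right.2 hsub, finsum_mem_inter_support, ← himage,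
      finsum_mem_image (by simpa using (C.circle i).injOn 0)]
    rw [← h2]
    exact finsum_mem_congr rfl hval

variable [Fintype ι]

theorem isRational {f : Γ → ℝ} {J : ι → ℝ → ℤ}
    (hJ : ∀ i t, HasJump (fun z => f (C.φ i z)) t (J i t)) : IsRational Γ f := by
  have hslope : ∀ P k, ∃ s, HasSlopeAlong f (C.arc P k) s := fun P k => by
    obtain ⟨s, hs, -⟩ := hJ k.1 (C.coord k.1 P)
    exact ⟨_, hs k.2⟩
  refine ⟨continuous_iff_continuousAt.2 fun P => ?_, fun P τ hτ => ?_⟩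
  · classical
    choose s hs using hslope P
    choose δ hδ H using hs
    obtain ⟨ε, hε, harc⟩ := C.exists_eq_arc P
    have hdist : Filter.Tendsto (fun x => dist x P) (nhds P) (nhds 0) := by
      simpa using (continuous_id.dist (continuous_const (y := P))).tendsto P
    have hev : ∀ᶠ x in nhds P, |f x - f P| ≤ (∑ k, |(s k : ℝ)|) * dist x P := by
      have h1 : ∀ᶠ x in nhds P, dist x P < ε := hdist.eventually_lt_const hε
      have h2 : ∀ᶠ x in nhds P, ∀ k, dist x P < δ k :=
        Filter.eventually_all.2 fun k => hdist.eventually_lt_const (hδ k)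
      filter_upwards [h1, h2] with x hx1 hx2
      obtain ⟨k, hk⟩ := harc x hx1
      have := H k (dist x P) ⟨dist_nonneg, (hx2 k).le⟩
      rw [← hk, (C.isArcAt_arc P k).1] at this
      rw [this, add_sub_cancel_left, abs_mul, abs_of_nonneg (dist_nonneg (x := x))]
      exact mul_le_mul_of_nonneg_right
        (Finset.single_le_sum (f := fun k => |(s k : ℝ)|) (fun _ _ => abs_nonneg _)
          (Finset.mem_univ k)) dist_nonneg
    refine tendsto_iff_dist_tendsto_zero.2 (squeeze_zero' (Filter.Eventually.of_forall
      fun _ => dist_nonneg) hev ?_)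
    simpa using hdist.const_mul (∑ k, |(s k : ℝ)|)
  · obtain ⟨k, hk⟩ := C.arc_complete P hτ
    obtain ⟨s, hs⟩ := hslope P k
    exact ⟨s, hs.congr_arc hk.symm⟩

theorem hasOrderAt_iff {f : Γ → ℝ} {J : ι → ℝ → ℤ}
    (hJ : ∀ i t, HasJump (fun z => f (C.φ i z)) t (J i t)) {P : Γ} {m : ℤ} :
    HasOrderAt Γ f P m ↔ m = ∑ i, C.jumpAt J i P := by
  classical
  have key : ∀ s : {i // P ∈ C.S i} × Bool → ℤ, (∀ k, HasSlopeAlong f (C.arc P k) (s k)) →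
      ∑ k, s k = ∑ i, C.jumpAt J i P := by
    intro s hs
    have : ∀ i : {i // P ∈ C.S i}, s (i, true) + s (i, false) = C.jumpAt J i P := by
      intro i
      obtain ⟨s', hs', e⟩ := hJ i (C.coord i P)
      rw [jumpAt, if_pos i.2, e, (hs (i, true)).unique (hs' true),
        (hs (i, false)).unique (hs' false)]
    rw [Fintype.sum_prod_type]
    simp only [Fintype.sum_bool, this]
    rw [← Finset.sum_subtype (Finset.univ.filter fun i => P ∈ C.S i) (by simp)
      (fun i => C.jumpAt J i P), Finset.sum_filter]
    refine Finset.sum_congr rfl fun i _ => ?_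
    unfold jumpAt
    split_ifs <;> rfl
  rw [(C.isArcSystem_arc P).hasOrderAt_iff]
  constructor
  · rintro ⟨s, hs, rfl⟩
    exact key s hs
  · rintro rfl
    choose s hs using fun k => (C.isRational hJ).2 _ _ (C.isArcAt_arc P k)
    exact ⟨s, hs, (key s hs).symm⟩

theorem isPrincipal_zero (C : Cactus Γ ι) : IsPrincipal Γ 0 := by
  have hJ : ∀ (i : ι) (t : ℝ), HasJump (fun z => (fun _ : Γ => (0 : ℝ)) (C.φ i z)) t 0 :=
    fun i t => hasJump_const 0 t
  refine ⟨fun _ => 0, C.isRational (J := fun _ _ => 0) hJ, fun P => ?_⟩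
  rw [C.hasOrderAt_iff (J := fun _ _ => 0) hJ]
  simp [jumpAt]

/-- Principal divisors on a cactus have degree zero. -/
theorem divDeg_eq_zero (C : Cactus Γ ι) {D : Divisor Γ} (hD : IsPrincipal Γ D) : divDeg D = 0 := by
  obtain ⟨f, hf, hord⟩ := hD
  obtain ⟨J, hJ⟩ := C.exists_hasJump hf
  have e : ∀ P, D P = ∑ i, C.jumpAt J i P := fun P => (C.hasOrderAt_iff hJ).1 (hord P)
  calc divDeg D = ∑ᶠ P, D P := by
        rw [divDeg, Finsupp.sum, finsum_eq_sum_of_support_subset]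
        simp
    _ = ∑ᶠ P, ∑ i, C.jumpAt J i P := finsum_congr e
    _ = ∑ i, ∑ᶠ P, C.jumpAt J i P :=
        finsum_sum_comm _ _ fun i _ => (C.finsum_jumpAt hJ i).1
    _ = 0 := Finset.sum_eq_zero fun i _ => (C.finsum_jumpAt hJ i).2

end Cactus

section Divisors

variable {Γ : Type*}

theorem divDeg_add (D D' : Divisor Γ) : divDeg (D + D') = divDeg D + divDeg D' :=
  Finsupp.sum_add_index' (fun _ => rfl) fun _ _ _ => rfl

theorem divDeg_sub (D D' : Divisor Γ) : divDeg (D - D') = divDeg D - divDeg D' :=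
  Finsupp.sum_sub_index fun _ _ _ => rfl

theorem divDeg_zero : divDeg (0 : Divisor Γ) = 0 := rfl

theorem divDeg_single (P : Γ) (n : ℤ) : divDeg (Finsupp.single P n) = n :=
  Finsupp.sum_single_index rfl

theorem Effective.divDeg_nonneg {D : Divisor Γ} (hD : Effective D) : 0 ≤ divDeg D :=
  Finset.sum_nonneg fun P _ => hD P

theorem Effective.add {D D' : Divisor Γ} (hD : Effective D) (hD' : Effective D') :
    Effective (D + D') := fun P => add_nonneg (hD P) (hD' P)

theorem effective_single (P : Γ) {n : ℤ} (hn : 0 ≤ n) : Effective (Finsupp.single P n) :=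
  fun Q => by
    classical
    rw [Finsupp.single_apply]
    split_ifs <;> simp [hn]

theorem exists_pos_of_divDeg_pos {D : Divisor Γ} (h : 0 < divDeg D) :
    ∃ P, 0 < D P := by
  by_contra! hcon
  exact h.not_ge (Finset.sum_nonpos fun P _ => hcon P)

theorem Effective.eq_zero {D : Divisor Γ} (hD : Effective D) (h : divDeg D = 0) : D = 0 := by
  ext P
  by_contra hP
  have := (Finset.sum_eq_zero_iff_of_nonneg fun Q _ => hD Q).1 h P (Finsupp.mem_support_iff.2 hP)
  exact hP this

theorem Effective.sub_single {D : Divisor Γ} (hD : Effective D) {P : Γ} (hP : 0 < D P) :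
    Effective (D - Finsupp.single P 1) := fun Q => by
  classical
  rw [Finsupp.sub_apply, Finsupp.single_apply]
  split_ifs with h
  · subst h
    linarith
  · simpa using hD Q

end Divisors

theorem CircleParam.hasJump_ramp {Γ : Type*} [MetricSpace Γ] {S : Set Γ} {L : ℝ} {φ : ℝ → Γ}
    (h : CircleParam S L φ) {s c z : ℝ} (hc : c ∈ Set.Icc s (s + L)) (hz : z ∈ Set.Ico s (s + L)) :
    HasJump (fun z => max (z - c) 0 + max (z - (c - L)) 0) z (Finsupp.single (φ c) 1 (φ z)) := by
  classical
  have e : Finsupp.single (φ c) (1 : ℤ) (φ z) =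
      (if z = c then 1 else 0) + (if z = c - L then 1 else 0) := by
    have hL := h.1
    rw [Finsupp.single_apply]
    rcases hc.2.lt_or_eq with hlt | heq
    · have h1 : φ c = φ z ↔ z = c :=
        ⟨fun e => (h.injOn s ⟨hc.1, hlt⟩ hz e).symm, fun e => by rw [e]⟩
      have h2 : z ≠ c - L := by linarith [hz.1]
      simp [h1, h2]
    · have h1 : φ c = φ z ↔ z = s := by
        rw [heq, h.2.1]
        exact ⟨fun e => (h.injOn s ⟨le_rfl, by linarith⟩ hz e).symm, fun e => by rw [e]⟩
      have h2 : z ≠ c := by linarith [hz.2]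
      have h3 : c - L = s := by linarith
      simp [h1, h2, h3]
  rw [e]
  exact (_root_.hasJump_ramp c z).add (_root_.hasJump_ramp (c - L) z)

namespace Cactus

variable {Γ : Type*} [MetricSpace Γ] {ι : Type*} (C : Cactus Γ ι) [Fintype ι]

/-- Two points of a circle can be moved towards each other at the same speed. -/
theorem isPrincipal_move (i : ι) {s u t : ℝ} (hsu : s ≤ u) (hut : u ≤ t) (hts : t ≤ s + C.L i) :
    IsPrincipal Γ (Finsupp.single (C.φ i s) 1 - Finsupp.single (C.φ i u) 1
      - Finsupp.single (C.φ i (s + t - u)) 1 + Finsupp.single (C.φ i t) 1) := by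
  classical
  have hcirc := C.circle i
  have hL := hcirc.1
  set D : Divisor Γ := Finsupp.single (C.φ i s) 1 - Finsupp.single (C.φ i u) 1
      - Finsupp.single (C.φ i (s + t - u)) 1 + Finsupp.single (C.φ i t) 1 with hD
  have hD0 : ∀ P, P ∉ C.S i → D P = 0 := fun P hP => by
    have : ∀ c, Finsupp.single (C.φ i c) (1 : ℤ) P = 0 := fun c => by
      rw [Finsupp.single_apply, if_neg]
      rintro rfl
      exact hP (hcirc.mem c)
    simp [hD, this]
  set h : ℝ → ℝ := fun z =>
    max (z - s) 0 - max (z - u) 0 - max (z - (s + t - u)) 0 + max (z - t) 0 with hh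
  have hleft : ∀ z ≤ s, h z = 0 := fun z hz => by
    simp only [hh]
    rw [max_eq_right (by linarith), max_eq_right (by linarith), max_eq_right (by linarith),
      max_eq_right (by linarith)]
    ring
  have hright : ∀ z, t ≤ z → h z = 0 := fun z hz => by
    simp only [hh]
    rw [max_eq_left (by linarith), max_eq_left (by linarith), max_eq_left (by linarith),
      max_eq_left (by linarith)]
    ring
  have hex : ∀ P, ∃ z, P ∈ C.S i → z ∈ Set.Ico s (s + C.L i) ∧ C.φ i z = P := fun P => by
    by_cases hP : P ∈ C.S i
    · obtain ⟨z, hz⟩ := hcirc.exists_mem_Ico s hP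
      exact ⟨z, fun _ => hz⟩
    · exact ⟨0, fun h => absurd h hP⟩
  choose θ hθ using hex
  have hθφ : ∀ z ∈ Set.Ico s (s + C.L i), θ (C.φ i z) = z := fun z hz =>
    hcirc.injOn s (hθ _ (hcirc.mem z)).1 hz (hθ _ (hcirc.mem z)).2
  let f : Γ → ℝ := fun P => h (θ (C.retr i P))
  have hfi : ∀ z, f (C.φ i z) = h (θ (C.φ i z)) := fun z => by
    simp only [f, C.retr_self i _ (hcirc.mem z)]
  let J : ι → ℝ → ℤ := fun j z => if j = i then D (C.φ i z) else 0
  have hJ : ∀ j z, HasJump (fun z => f (C.φ j z)) z (J j z) := by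
    intro j z
    by_cases hji : j = i
    · subst hji
      have hfund : ∀ z ∈ Set.Ico s (s + C.L j),
          HasJump (fun z => f (C.φ j z)) z (D (C.φ j z)) := by
        intro z hz
        have hg := (((hcirc.hasJump_ramp (c := s) ⟨by linarith, by linarith⟩ hz).sub
          (hcirc.hasJump_ramp (c := u) ⟨by linarith, by linarith⟩ hz)).sub
          (hcirc.hasJump_ramp (c := s + t - u) ⟨by linarith, by linarith⟩ hz)).add
          (hcirc.hasJump_ramp (c := t) ⟨by linarith, by linarith⟩ hz)
        refine HasJump.congr hg (a := s - C.L j) (b := s + C.L j) (by linarith [hz.1]) hz.2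
          fun x hx1 hx2 => ?_
        have hsplit : f (C.φ j x) = h x + h (x + C.L j) := by
          rw [hfi]
          rcases lt_or_ge x s with hxs | hxs
          · rw [hleft x hxs.le, ← hcirc.2.1, hθφ _ ⟨by linarith, by linarith⟩, zero_add]
          · rw [hright (x + C.L j) (by linarith), hθφ _ ⟨hxs, hx2⟩, add_zero]
        have hsh : ∀ c, x + C.L j - c = x - (c - C.L j) := fun c => by ring
        rw [hsplit]
        simp only [hh, hsh]
        ring
      obtain ⟨k, hk, -⟩ := existsUnique_add_zsmul_mem_Ico hL z s
      have hper : Function.Periodic (fun z => f (C.φ j z)) (C.L j) := fun z =>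
        congrArg f (hcirc.2.1 z)
      have := (hfund _ hk).periodic hper (-k)
      have e : z + k • C.L j + ((-k : ℤ) : ℝ) * C.L j = z := by
        push_cast
        rw [zsmul_eq_mul]
        ring
      rw [e, zsmul_eq_mul, hcirc.periodic.int_mul k z] at this
      simpa [J] using this
    · have : (fun z => f (C.φ j z)) = fun _ => f (C.φ j 0) := funext fun z =>
        congrArg (fun P => h (θ P)) (C.retr_const i j (Ne.symm hji) _ ((C.circle j).mem z) _
          ((C.circle j).mem 0))
      rw [this]
      simpa [J, hji] using hasJump_const (f (C.φ j 0)) z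
  refine ⟨f, C.isRational hJ, fun P => ?_⟩
  rw [C.hasOrderAt_iff hJ, Finset.sum_eq_single i]
  · unfold jumpAt
    split_ifs with hP
    · simp [J, (C.coord_spec hP).2]
    · exact hD0 P hP
  · intro j _ hji
    simp [jumpAt, J, hji]
  · simp

theorem exists_move {i : ι} {p q x : Γ} (hp : p ∈ C.S i) (hq : q ∈ C.S i) (hx : x ∈ C.S i) :
    ∃ y ∈ C.S i, IsPrincipal Γ (Finsupp.single p 1 + Finsupp.single q 1
      - Finsupp.single x 1 - Finsupp.single y 1) := by
  have hcirc := C.circle i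
  obtain ⟨s, -, rfl⟩ := hcirc.exists_mem_Ico 0 hp
  obtain ⟨t, ht, rfl⟩ := hcirc.exists_mem_Ico s hq
  obtain ⟨u, hu, rfl⟩ := hcirc.exists_mem_Ico s hx
  rcases le_total u t with h | h
  · refine ⟨_, hcirc.mem (s + t - u), ?_⟩
    convert C.isPrincipal_move i hu.1 h ht.2.le using 1
    abel
  · refine ⟨_, hcirc.mem (t + (s + C.L i) - u), ?_⟩
    have := C.isPrincipal_move i h hu.2.le (by linarith [ht.1])
    rw [hcirc.2.1 s] at this
    convert this using 1
    abel

/-- On a circle every divisor is equivalent to a point plus a multiple of a given point. -/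
theorem exists_concentrate {i : ι} {q : Γ} (hq : q ∈ C.S i) (D : Divisor Γ)
    (hD : ∀ P, D P ≠ 0 → P ∈ C.S i) :
    ∃ y ∈ C.S i, IsPrincipal Γ (D - Finsupp.single y 1 - Finsupp.single q (divDeg D - 1)) := by
  induction D using Finsupp.induction with
  | zero =>
    refine ⟨q, hq, ?_⟩
    convert C.isPrincipal_zero using 1
    rw [divDeg_zero, zero_sub, zero_sub, Finsupp.single_neg]
    abel
  | single_add p n D hp hn ih =>
    have hp0 : D p = 0 := Finsupp.notMem_support_iff.1 hp
    have hpS : p ∈ C.S i := hD p (by simpa [hp0] using hn)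
    have ih := ih fun P hP => hD P (by
      have : p ≠ P := fun h => hP (h ▸ hp0)
      simpa [Finsupp.single_eq_of_ne this.symm] using hP)
    clear hD hp hn hp0
    have step : ∀ D : Divisor Γ,
        (∃ y ∈ C.S i, IsPrincipal Γ
          (D - Finsupp.single y 1 - Finsupp.single q (divDeg D - 1))) →
        (∃ y ∈ C.S i, IsPrincipal Γ ((Finsupp.single p 1 + D) - Finsupp.single y 1
          - Finsupp.single q (divDeg (Finsupp.single p 1 + D) - 1))) ∧
        ∃ y ∈ C.S i, IsPrincipal Γ ((D - Finsupp.single p 1) - Finsupp.single y 1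
          - Finsupp.single q (divDeg (D - Finsupp.single p 1) - 1)) := by
      rintro D ⟨y, hy, H⟩
      obtain ⟨y₁, hy₁, H₁⟩ := C.exists_move hy hpS hq
      obtain ⟨y₂, hy₂, H₂⟩ := C.exists_move hy hq hpS
      refine ⟨⟨y₁, hy₁, ?_⟩, ⟨y₂, hy₂, ?_⟩⟩
      · convert H.add H₁ using 1
        rw [divDeg_add, divDeg_single, add_sub_cancel_left, Finsupp.single_sub]
        abel
      · convert H.add H₂ using 1
        rw [divDeg_sub, divDeg_single, Finsupp.single_sub, Finsupp.single_sub]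
        abel
    induction n using Int.induction_on with
    | zero => simpa using ih
    | succ n ih' =>
      rw [add_comm (n : ℤ), Finsupp.single_add, add_assoc]
      exact (step _ ih').1
    | pred n ih' =>
      rw [Finsupp.single_sub, sub_add_eq_add_sub]
      exact (step _ ih').2

/-- A divisor on a chain of `a + 1` circles is equivalent to an effective divisor of degree
`a + 1` plus a multiple of a given point. -/
theorem exists_chain (c : ℕ → ι) (a : ℕ)
    (hw : ∀ k < a, (C.S (c k) ∩ C.S (c (k + 1))).Nonempty) (q : Γ) (hq : q ∈ C.S (c a))
    (D : Divisor Γ) (hD : ∀ P, D P ≠ 0 → ∃ k ≤ a, P ∈ C.S (c k)) :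
    ∃ F, Effective F ∧ IsPrincipal Γ (D - F - Finsupp.single q (divDeg D - (a + 1))) := by
  classical
  induction a generalizing q D with
  | zero =>
    obtain ⟨y, -, H⟩ := C.exists_concentrate hq D fun P hP => by
      obtain ⟨k, hk, h⟩ := hD P hP
      rwa [Nat.le_zero.1 hk] at h
    exact ⟨_, effective_single y zero_le_one, by simpa using H⟩
  | succ a ih =>
    obtain ⟨w, hw1, hw2⟩ := hw a (Nat.lt_succ_self a)
    set D₁ := D.filter fun P => ∃ k ≤ a, P ∈ C.S (c k) with hD₁
    set D₂ := D.filter fun P => ¬ ∃ k ≤ a, P ∈ C.S (c k) with hD₂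
    have hsum : D₁ + D₂ = D := Finsupp.filter_add_filter_not _ _
    obtain ⟨F, hF, H⟩ := ih (fun k hk => hw k (hk.trans (Nat.lt_succ_self a))) w hw1 D₁
      fun P hP => by
        by_contra hcon
        exact hP (Finsupp.filter_apply_neg _ _ hcon)
    obtain ⟨y, -, H'⟩ := C.exists_concentrate hq
      (Finsupp.single w (divDeg D₁ - (a + 1)) + D₂) fun P hP => by
        by_cases hPw : P = w
        · rwa [hPw]
        · rw [Finsupp.add_apply, Finsupp.single_eq_of_ne hPw, zero_add] at hP
          have hcon : ¬ ∃ k ≤ a, P ∈ C.S (c k) := fun h =>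
            hP (Finsupp.filter_apply_neg _ _ (not_not.2 h))
          rw [hD₂, Finsupp.filter_apply_pos (fun P => ¬ ∃ k ≤ a, P ∈ C.S (c k)) _ hcon] at hP
          obtain ⟨k, hk, h⟩ := hD P hP
          rcases hk.lt_or_eq with hlt | heq
          · exact absurd ⟨k, Nat.lt_succ_iff.1 hlt, h⟩ hcon
          · exact heq ▸ h
    refine ⟨F + Finsupp.single y 1, hF.add (effective_single y zero_le_one), ?_⟩
    have hdeg : divDeg (Finsupp.single w (divDeg D₁ - (a + 1)) + D₂) - 1 =
        divDeg D - ((a + 1 : ℕ) + 1) := by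
      rw [divDeg_add, divDeg_single, ← hsum, divDeg_add]
      push_cast
      ring
    rw [hdeg] at H'
    convert H.add H' using 1
    rw [← hsum]
    abel

/-- If every point outside `Γ₀` lies on a circle meeting `Γ₀`, then subtracting an effective
divisor of degree `n` from a divisor on `Γ₀` costs at most degree `2n` on `Γ₀`. -/
theorem exists_peel (Γ₀ : Set Γ) (h : ∀ x ∉ Γ₀, ∃ i, ∃ v ∈ Γ₀, x ∈ C.S i ∧ v ∈ C.S i)
    (n : ℕ) (E : Divisor Γ) (hE : Effective E) (hdeg : divDeg E = n) (D : Divisor Γ)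
    (hD : ∀ P, D P ≠ 0 → P ∈ Γ₀) :
    ∃ D₀ F, Effective F ∧ (∀ P, D₀ P ≠ 0 → P ∈ Γ₀) ∧ divDeg D - 2 * n ≤ divDeg D₀ ∧
      IsPrincipal Γ (D - E - D₀ - F) := by
  induction n generalizing E D with
  | zero =>
    refine ⟨D, 0, fun _ => le_rfl, hD, by simp, ?_⟩
    rw [hE.eq_zero hdeg]
    simpa using C.isPrincipal_zero
  | succ n ih =>
    obtain ⟨P, hP⟩ := exists_pos_of_divDeg_pos (D := E) (by rw [hdeg]; positivity)
    have hsupp : ∀ v ∈ Γ₀, ∀ m : ℤ, ∀ Q, (D - Finsupp.single v m) Q ≠ 0 → Q ∈ Γ₀ := by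
      intro v hv m Q hQ
      by_cases hvQ : Q = v
      · rwa [hvQ]
      · rw [Finsupp.sub_apply, Finsupp.single_eq_of_ne hvQ, sub_zero] at hQ
        exact hD Q hQ
    have hdeg' : divDeg (E - Finsupp.single P 1) = n := by
      rw [divDeg_sub, divDeg_single, hdeg]
      push_cast
      ring
    by_cases hPΓ : P ∈ Γ₀
    · obtain ⟨D₀, F, hF, hD₀, hle, H⟩ :=
        ih _ (hE.sub_single hP) hdeg' (D - Finsupp.single P 1) (hsupp P hPΓ 1)
      refine ⟨D₀, F, hF, hD₀, ?_, ?_⟩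
      · rw [divDeg_sub, divDeg_single] at hle
        push_cast
        linarith
      · convert H using 1
        abel
    · obtain ⟨i, v, hv, hPi, hvi⟩ := h P hPΓ
      obtain ⟨y, -, hy⟩ := C.exists_move hvi hvi hPi
      obtain ⟨D₀, F, hF, hD₀, hle, H⟩ :=
        ih _ (hE.sub_single hP) hdeg' (D - Finsupp.single v 2) (hsupp v hv 2)
      refine ⟨D₀, F + Finsupp.single y 1, hF.add (effective_single y zero_le_one), hD₀, ?_, ?_⟩
      · rw [divDeg_sub, divDeg_single] at hle
        push_cast
        linarith
      · convert H.add hy using 1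
        rw [show (2 : ℤ) = 1 + 1 from rfl, Finsupp.single_add]
        abel

theorem le_divDeg_of_rankGE [Nonempty Γ] (C : Cactus Γ ι) {D : Divisor Γ} {n : ℕ}
    (h : RankGE Γ D n) : (n : ℤ) ≤ divDeg D := by
  obtain ⟨P⟩ := ‹Nonempty Γ›
  obtain ⟨D', hD', f, hf, hord⟩ := h (Finsupp.single P (n : ℤ)) (effective_single P (by positivity))
    (divDeg_single P n)
  have h0 := C.divDeg_eq_zero (D := D' - (D - Finsupp.single P (n : ℤ))) ⟨f, hf, hord⟩
  rw [divDeg_sub, divDeg_sub, divDeg_single] at h0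
  linarith [hD'.divDeg_nonneg]

theorem le_divRank [Nonempty Γ] (C : Cactus Γ ι) {D : Divisor Γ} {n : ℕ} (h : RankGE Γ D n) :
    (n : ℤ) ≤ divRank Γ D := by
  refine le_csSup ⟨max (-1) (divDeg D), ?_⟩ (Or.inr ⟨n, rfl, h⟩)
  rintro m (rfl | ⟨k, rfl, hk⟩)
  · exact le_max_left _ _
  · exact (C.le_divDeg_of_rankGE hk).trans (le_max_right _ _)

end Cactus

namespace ChainPlusLoops

variable {a g : ℕ} (C : ChainPlusLoops a g)

theorem loop_subset {i : ℕ} (hi : i ∈ Finset.Icc 1 a) : C.loop i ⊆ C.Γ₀ := by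
  rw [C.hΓ₀]
  exact Set.subset_biUnion_of_mem (u := C.loop) hi

theorem exists_loop {x : C.Γ} (hx : x ∈ C.Γ₀) : ∃ i ∈ Finset.Icc 1 a, x ∈ C.loop i := by
  rw [C.hΓ₀] at hx
  simpa only [Set.mem_iUnion, exists_prop] using hx

theorem exists_attached {x : C.Γ} (hx : x ∉ C.Γ₀) :
    ∃ i ∈ Finset.Icc (a + 1) g, x ∈ C.loop i := by
  have : x ∈ C.Γ₀ ∪ ⋃ i ∈ Finset.Icc (a + 1) g, C.loop i := C.cover ▸ Set.mem_univ x
  simpa only [Set.mem_iUnion, exists_prop] using this.resolve_left hx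

theorem eq_v {i : ℕ} (hi : i ∈ Finset.Icc (a + 1) g) {x : C.Γ} (hx : x ∈ C.loop i)
    (hx₀ : x ∈ C.Γ₀) : x = C.v i :=
  Set.mem_singleton_iff.1 ((C.attachMeet i hi).subset ⟨hx, hx₀⟩)

theorem v_mem {i : ℕ} (hi : i ∈ Finset.Icc (a + 1) g) : C.v i ∈ C.loop i :=
  ((C.attachMeet i hi).symm ▸ Set.mem_singleton (C.v i) : C.v i ∈ C.loop i ∩ C.Γ₀).1

theorem eq_w {i j : ℕ} (hi : 1 ≤ i) (hj : j ≤ a) (hij : i < j) {x : C.Γ} (hxi : x ∈ C.loop i)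
    (hxj : x ∈ C.loop j) : j = i + 1 ∧ x = C.w i := by
  rcases (Nat.succ_le_of_lt hij).eq_or_lt with h | h
  · subst h
    exact ⟨rfl, Set.mem_singleton_iff.1
      ((C.chainMeet i (Finset.mem_Icc.2 ⟨hi, by omega⟩)).subset ⟨hxi, hxj⟩)⟩
  · have := C.chainDisj i (Finset.mem_Icc.2 ⟨hi, by omega⟩) j
      (Finset.mem_Icc.2 ⟨by omega, hj⟩) h
    exact absurd (this.subset ⟨hxi, hxj⟩) (Set.notMem_empty x)

theorem inter_subsingleton {i j : ℕ} (hi : 1 ≤ i) (hij : i < j) (hj : j ≤ g) :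
    (C.loop i ∩ C.loop j).Subsingleton := by
  rintro x ⟨hxi, hxj⟩ y ⟨hyi, hyj⟩
  by_cases hja : j ≤ a
  · rw [(C.eq_w hi hja hij hxi hxj).2, (C.eq_w hi hja hij hyi hyj).2]
  · have hj' : j ∈ Finset.Icc (a + 1) g := Finset.mem_Icc.2 ⟨by omega, hj⟩
    by_cases hia : i ≤ a
    · have hi' := C.loop_subset (Finset.mem_Icc.2 ⟨hi, hia⟩)
      rw [C.eq_v hj' hxj (hi' hxi), C.eq_v hj' hyj (hi' hyi)]
    · have := C.attachDisj i (Finset.mem_Icc.2 ⟨by omega, by omega⟩) j hj' hij.ne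
      exact absurd (this.subset ⟨hxi, hxj⟩) (Set.notMem_empty x)

/-- The retraction to the chain contracting every attached loop. -/
theorem exists_base (x : C.Γ) : ∃ b, (x ∈ C.Γ₀ → b = x) ∧
    ∀ k ∈ Finset.Icc (a + 1) g, x ∈ C.loop k → b = C.v k := by
  by_cases hx : x ∈ C.Γ₀
  · exact ⟨x, fun _ => rfl, fun k hk hxk => C.eq_v hk hxk hx⟩
  · obtain ⟨i, hi, hxi⟩ := C.exists_attached hx
    refine ⟨C.v i, fun h => absurd h hx, fun k hk hxk => ?_⟩
    by_cases hik : i = k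
    · rw [hik]
    · exact absurd ((C.attachDisj i hi k hk hik).subset ⟨hxi, hxk⟩) (Set.notMem_empty x)

/-- The retraction of the chain to one of its loops. -/
theorem exists_retr_chain {i : ℕ} (hi : i ∈ Finset.Icc 1 a) (x : C.Γ) :
    ∃ y, (x ∈ C.loop i → y = x) ∧ ∀ j ∈ Finset.Icc 1 a,
      (j < i → x ∈ C.loop j → y = C.w (i - 1)) ∧ (i < j → x ∈ C.loop j → y = C.w i) := by
  obtain ⟨hi1, hia⟩ := Finset.mem_Icc.1 hi
  by_cases hx : x ∈ C.loop i
  · refine ⟨x, fun _ => rfl, fun j hj => ⟨fun hji hxj => ?_, fun hij hxj => ?_⟩⟩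
    · obtain ⟨e, h⟩ := C.eq_w (Finset.mem_Icc.1 hj).1 hia hji hxj hx
      rw [h, e, Nat.add_sub_cancel]
    · exact (C.eq_w hi1 (Finset.mem_Icc.1 hj).2 hij hx hxj).2
  · by_cases hlow : ∃ j ∈ Finset.Icc 1 a, j < i ∧ x ∈ C.loop j
    · obtain ⟨l, hl, hli, hxl⟩ := hlow
      refine ⟨C.w (i - 1), fun h => absurd h hx, fun j hj => ⟨fun _ _ => rfl, fun hij hxj => ?_⟩⟩
      have := (C.eq_w (Finset.mem_Icc.1 hl).1 (Finset.mem_Icc.1 hj).2 (hli.trans hij) hxl hxj).1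
      omega
    · exact ⟨C.w i, fun h => absurd h hx, fun j hj =>
        ⟨fun hji hxj => absurd ⟨j, hj, hji, hxj⟩ hlow, fun _ _ => rfl⟩⟩

theorem exists_retr {i : ℕ} (hi : i ∈ Finset.Icc 1 g) :
    ∃ ρ : C.Γ → C.Γ, (∀ x ∈ C.loop i, ρ x = x) ∧
      ∀ j ∈ Finset.Icc 1 g, i ≠ j → ∀ x ∈ C.loop j, ∀ y ∈ C.loop j, ρ x = ρ y := by
  classical
  obtain ⟨hi1, hig⟩ := Finset.mem_Icc.1 hi
  by_cases hia : i ≤ a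
  · have hi' : i ∈ Finset.Icc 1 a := Finset.mem_Icc.2 ⟨hi1, hia⟩
    choose b hb using C.exists_base
    choose r hr using C.exists_retr_chain hi'
    refine ⟨fun x => r (b x), fun x hx => ?_, fun j hj hij x hx y hy => ?_⟩
    · simp only [(hb x).1 (C.loop_subset hi' hx), (hr x).1 hx]
    · obtain ⟨hj1, hjg⟩ := Finset.mem_Icc.1 hj
      by_cases hja : j ≤ a
      · have hj' : j ∈ Finset.Icc 1 a := Finset.mem_Icc.2 ⟨hj1, hja⟩
        simp only [(hb x).1 (C.loop_subset hj' hx), (hb y).1 (C.loop_subset hj' hy)]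
        rcases hij.lt_or_gt with h | h
        · rw [((hr x).2 j hj').2 h hx, ((hr y).2 j hj').2 h hy]
        · rw [((hr x).2 j hj').1 h hx, ((hr y).2 j hj').1 h hy]
      · have hj' : j ∈ Finset.Icc (a + 1) g := Finset.mem_Icc.2 ⟨by omega, hjg⟩
        simp only [(hb x).2 j hj' hx, (hb y).2 j hj' hy]
  · have hi' : i ∈ Finset.Icc (a + 1) g := Finset.mem_Icc.2 ⟨by omega, hig⟩
    have key : ∀ j ∈ Finset.Icc 1 g, i ≠ j → ∀ x ∈ C.loop j,
        (if x ∈ C.loop i then x else C.v i) = C.v i := by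
      intro j hj hij x hxj
      obtain ⟨hj1, hjg⟩ := Finset.mem_Icc.1 hj
      split_ifs with hxi
      · by_cases hja : j ≤ a
        · exact C.eq_v hi' hxi (C.loop_subset (Finset.mem_Icc.2 ⟨hj1, hja⟩) hxj)
        · exact absurd ((C.attachDisj i hi' j (Finset.mem_Icc.2 ⟨by omega, hjg⟩) hij).subset
            ⟨hxi, hxj⟩) (Set.notMem_empty x)
      · rfl
    refine ⟨fun x => if x ∈ C.loop i then x else C.v i, fun x hx => if_pos hx,
      fun j hj hij x hx y hy => ?_⟩
    simp only [key j hj hij x hx, key j hj hij y hy]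

theorem exists_cactus : ∃ K : Cactus C.Γ {i // i ∈ Finset.Icc 1 g}, ∀ i, K.S i = C.loop i := by
  choose L φ hφ using fun i : {i // i ∈ Finset.Icc 1 g} => C.circle i i.2
  choose ρ hρ using fun i : {i // i ∈ Finset.Icc 1 g} => C.exists_retr i.2
  refine ⟨⟨fun i => C.loop i, L, φ, hφ, fun i => C.closedLoop i i.2, fun x => ?_,
    fun i j hij => ?_, ρ, fun i => (hρ i).1,
    fun i j hij => (hρ i).2 j j.2 (Subtype.coe_injective.ne hij)⟩, fun i => rfl⟩
  · have := C.hg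
    by_cases hx : x ∈ C.Γ₀
    · obtain ⟨i, hi, h⟩ := C.exists_loop hx
      rw [Finset.mem_Icc] at hi
      exact ⟨⟨i, Finset.mem_Icc.2 ⟨hi.1, by omega⟩⟩, h⟩
    · obtain ⟨i, hi, h⟩ := C.exists_attached hx
      rw [Finset.mem_Icc] at hi
      exact ⟨⟨i, Finset.mem_Icc.2 ⟨by omega, hi.2⟩⟩, h⟩
  · have hi := Finset.mem_Icc.1 i.2
    have hj := Finset.mem_Icc.1 j.2
    rcases (Subtype.coe_injective.ne hij).lt_or_gt with h | h
    · exact C.inter_subsingleton hi.1 h hj.2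
    · rw [Set.inter_comm]
      exact C.inter_subsingleton hj.1 h hi.2

/-- A divisor on the chain of degree at least `a` is equivalent to an effective divisor. -/
theorem exists_effective (K : Cactus C.Γ {i // i ∈ Finset.Icc 1 g}) (hK : ∀ i, K.S i = C.loop i)
    (D : Divisor C.Γ) (hD : ∀ P, D P ≠ 0 → P ∈ C.Γ₀) (hdeg : (a : ℤ) ≤ divDeg D) :
    ∃ F, Effective F ∧ IsPrincipal C.Γ (D - F) := by
  have ha := C.ha
  have hg := C.hg
  let c : ℕ → {i // i ∈ Finset.Icc 1 g} := fun k =>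
    ⟨min (k + 1) g, Finset.mem_Icc.2 ⟨by omega, min_le_right _ _⟩⟩
  have hc : ∀ k < a, K.S (c k) = C.loop (k + 1) := fun k hk => by
    rw [hK]
    simp only [c]
    rw [min_eq_left (by omega)]
  have hq := C.hvg'
  obtain ⟨F, hF, H⟩ := K.exists_chain c (a - 1)
    (fun k hk => by
      rw [hc k (by omega), hc (k + 1) (by omega),
        C.chainMeet (k + 1) (Finset.mem_Icc.2 ⟨by omega, by omega⟩)]
      exact Set.singleton_nonempty _)
    (C.v (g - 1))
    (by rwa [hc _ (by omega), Nat.sub_add_cancel ha])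
    D fun P hP => by
      obtain ⟨i, hi, h⟩ := C.exists_loop (hD P hP)
      rw [Finset.mem_Icc] at hi
      exact ⟨i - 1, by omega, by rwa [hc _ (by omega), Nat.sub_add_cancel hi.1]⟩
  refine ⟨_, hF.add (effective_single (C.v (g - 1))
    (n := divDeg D - (((a - 1 : ℕ) : ℤ) + 1)) (by omega)), ?_⟩
  rwa [← sub_sub]

end ChainPlusLoops

/-- In the chain-plus-loops graph `Γ`, an effective divisor of degree
`a + 2r` supported on `Γ₀` has rank at least `r` on `Γ`, for `1 ≤ r ≤ g - a - 2`. -/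
theorem statement6 (a g : ℕ) (C : ChainPlusLoops a g) (r : ℕ)
    (hr1 : 1 ≤ r) (hr2 : r + a + 2 ≤ g)
    (D : Divisor C.Γ) (hD : Effective D) (hs : ↑D.support ⊆ C.Γ₀)
    (hdeg : divDeg D = (a : ℤ) + 2 * r) :
    (r : ℤ) ≤ divRank C.Γ D := by
  obtain ⟨K, hK⟩ := C.exists_cactus
  have hg := C.hg
  have : Nonempty C.Γ := ⟨C.v g⟩
  refine K.le_divRank fun E hE hEdeg => ?_
  obtain ⟨D₀, F, hF, hD₀, hle, H⟩ := K.exists_peel C.Γ₀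
    (fun x hx => by
      obtain ⟨i, hi, hxi⟩ := C.exists_attached hx
      have hi' := Finset.mem_Icc.1 hi
      refine ⟨⟨i, Finset.mem_Icc.2 ⟨by omega, hi'.2⟩⟩, C.v i, C.hvMem i hi, ?_, ?_⟩
      · rwa [hK]
      · rw [hK]
        exact C.v_mem hi)
    r E hE hEdeg D fun P hP => hs (Finsupp.mem_support_iff.2 hP)
  obtain ⟨F', hF', H'⟩ := C.exists_effective K hK D₀ hD₀ (by linarith)
  obtain ⟨f, hf, hord⟩ := (H.add H').neg
  refine ⟨F + F', hF.add hF', f, hf, fun P => ?_⟩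
  convert hord P using 1
  simp only [Finsupp.add_apply, Finsupp.sub_apply, Finsupp.neg_apply]
  ring
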